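/- arXiv:2210.16482 — 2 statements merged into one kernel-verified Lean document; each statement's English description precedes it below -/
import Mathlib

section
/- Under Assumption 1, for every reasoning level k ≥ 1 the Lv.k GP reasoning iterates satisfy ‖ω_t^(k) − ω_t^(k−1)‖ ≤ η·(ηL)^(k−1)·Δ_max; in fact the stronger bound ‖θ_t^(k) − θ_t^(k−1)‖ + ‖φ_t^(k) − φ_t^(k−1)‖ ≤ η·(ηL)^(k−1)·Δ_max holds. -/
open Filter Topology

/-- consecutive Lv.k GP reasoning iterates satisfy
`‖ω_t^(k) − ω_t^(k−1)‖ ≤ η (ηL)^(k−1) Δ_max`, and in fact the stronger bound on the sum of the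
two component norms holds. -/
theorem lvk_gp_consecutive_iterate_bound
    (m n : ℕ)
    (f g : EuclideanSpace ℝ (Fin m) → EuclideanSpace ℝ (Fin n) → ℝ)
    (hfdiff : ∀ φ, Differentiable ℝ (fun θ => f θ φ))
    (hgdiff : ∀ θ, Differentiable ℝ (fun φ => g θ φ))
    (Lθθ Lθφ Lφθ Lφφ L : ℝ)
    (hL : L = max (max Lθθ Lθφ) (max Lφθ Lφφ))
    (hLip1 : ∀ (φ : EuclideanSpace ℝ (Fin n)) (θ₁ θ₂ : EuclideanSpace ℝ (Fin m)),
      ‖gradient (fun θ => f θ φ) θ₁ - gradient (fun θ => f θ φ) θ₂‖ ≤ Lθθ * ‖θ₁ - θ₂‖)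
    (hLip2 : ∀ (θ : EuclideanSpace ℝ (Fin m)) (φ₁ φ₂ : EuclideanSpace ℝ (Fin n)),
      ‖gradient (fun θ' => f θ' φ₁) θ - gradient (fun θ' => f θ' φ₂) θ‖ ≤ Lθφ * ‖φ₁ - φ₂‖)
    (hLip3 : ∀ (φ : EuclideanSpace ℝ (Fin n)) (θ₁ θ₂ : EuclideanSpace ℝ (Fin m)),
      ‖gradient (fun φ' => g θ₁ φ') φ - gradient (fun φ' => g θ₂ φ') φ‖ ≤ Lφθ * ‖θ₁ - θ₂‖)
    (hLip4 : ∀ (θ : EuclideanSpace ℝ (Fin m)) (φ₁ φ₂ : EuclideanSpace ℝ (Fin n)),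
      ‖gradient (fun φ' => g θ φ') φ₁ - gradient (fun φ' => g θ φ') φ₂‖ ≤ Lφφ * ‖φ₁ - φ₂‖)
    (η : ℝ) (hη : 0 < η)
    (θt : EuclideanSpace ℝ (Fin m)) (φt : EuclideanSpace ℝ (Fin n))
    (Θ : ℕ → EuclideanSpace ℝ (Fin m)) (Φ : ℕ → EuclideanSpace ℝ (Fin n))
    (hΘ0 : Θ 0 = θt) (hΦ0 : Φ 0 = φt)
    (hΘ : ∀ k : ℕ, Θ (k + 1) = θt - η • gradient (fun θ => f θ (Φ k)) θt)
    (hΦ : ∀ k : ℕ, Φ (k + 1) = φt - η • gradient (fun φ => g (Θ k) φ) φt)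
    (Δmax : ℝ)
    (hΔ : Δmax = 2 * max ‖gradient (fun θ => f θ φt) θt‖ ‖gradient (fun φ => g θt φ) φt‖)
    (k : ℕ) (hk : 1 ≤ k) :
    Real.sqrt (‖Θ k - Θ (k - 1)‖ ^ 2 + ‖Φ k - Φ (k - 1)‖ ^ 2) ≤ η * (η * L) ^ (k - 1) * Δmax ∧
    ‖Θ k - Θ (k - 1)‖ + ‖Φ k - Φ (k - 1)‖ ≤ η * (η * L) ^ (k - 1) * Δmax := by
  have h1 : Lθθ ≤ L := by rw [hL]; simp
  have h2 : Lθφ ≤ L := by rw [hL]; simp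
  have h3 : Lφθ ≤ L := by rw [hL]; simp
  have h4 : Lφφ ≤ L := by rw [hL]; simp
  have key : ∀ j : ℕ, ‖Θ (j + 1) - Θ j‖ + ‖Φ (j + 1) - Φ j‖ ≤ η * (η * L) ^ j * Δmax := by
    rcases lt_or_ge L 0 with hneg | hpos
    · have hθ : ∀ x : EuclideanSpace ℝ (Fin m), ‖x‖ = 0 := by
        intro x
        have h := (norm_nonneg _).trans (hLip1 φt x 0)
        rw [sub_zero] at h
        have hx := norm_nonneg x
        nlinarith
      have hφ : ∀ x : EuclideanSpace ℝ (Fin n), ‖x‖ = 0 := by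
        intro x
        have h := (norm_nonneg _).trans (hLip4 θt x 0)
        rw [sub_zero] at h
        have hx := norm_nonneg x
        nlinarith
      intro j
      rw [hΔ]
      simp only [hθ, hφ]
      simp
    · intro j
      induction j with
      | zero =>
        have e1 : Θ (0 + 1) - Θ 0 = -(η • gradient (fun θ => f θ φt) θt) := by
          rw [hΘ, hΘ0, hΦ0]; abel
        have e2 : Φ (0 + 1) - Φ 0 = -(η • gradient (fun φ => g θt φ) φt) := by
          rw [hΦ, hΘ0, hΦ0]; abel
        rw [e1, e2, norm_neg, norm_neg, norm_smul, norm_smul, Real.norm_of_nonneg hη.le, hΔ]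
        have a1 := mul_le_mul_of_nonneg_left (le_max_left ‖gradient (fun θ => f θ φt) θt‖
          ‖gradient (fun φ => g θt φ) φt‖) hη.le
        have a2 := mul_le_mul_of_nonneg_left (le_max_right ‖gradient (fun θ => f θ φt) θt‖
          ‖gradient (fun φ => g θt φ) φt‖) hη.le
        rw [pow_zero]
        linarith
      | succ j ih =>
        have e1 : Θ (j + 1 + 1) - Θ (j + 1) = -(η • (gradient (fun θ => f θ (Φ (j + 1))) θt
            - gradient (fun θ => f θ (Φ j)) θt)) := by
          rw [hΘ (j + 1), hΘ j, smul_sub]; abel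
        have e2 : Φ (j + 1 + 1) - Φ (j + 1) = -(η • (gradient (fun φ => g (Θ (j + 1)) φ) φt
            - gradient (fun φ => g (Θ j) φ) φt)) := by
          rw [hΦ (j + 1), hΦ j, smul_sub]; abel
        rw [e1, e2, norm_neg, norm_neg, norm_smul, norm_smul, Real.norm_of_nonneg hη.le]
        have b1 := mul_le_mul_of_nonneg_left ((hLip2 θt (Φ (j + 1)) (Φ j)).trans
          (mul_le_mul_of_nonneg_right h2 (norm_nonneg _))) hη.le
        have b2 := mul_le_mul_of_nonneg_left ((hLip3 φt (Θ (j + 1)) (Θ j)).trans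
          (mul_le_mul_of_nonneg_right h3 (norm_nonneg _))) hη.le
        have b3 := mul_le_mul_of_nonneg_left ih (mul_nonneg hη.le hpos)
        calc _ ≤ _ := add_le_add b1 b2
          _ = η * L * (‖Θ (j + 1) - Θ j‖ + ‖Φ (j + 1) - Φ j‖) := by ring
          _ ≤ _ := b3
          _ = _ := by ring
  obtain ⟨j, rfl⟩ : ∃ j, k = j + 1 := ⟨k - 1, by omega⟩
  rw [Nat.add_sub_cancel]
  refine ⟨le_trans ?_ (key j), key j⟩
  have p := norm_nonneg (Θ (j + 1) - Θ j)
  have q := norm_nonneg (Φ (j + 1) - Φ j)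
  refine Real.sqrt_le_iff.mpr ⟨add_nonneg p q, ?_⟩
  nlinarith [mul_nonneg p q]
end

section
/- Let B be a real m×n matrix, η ∈ ℝ, and k a positive integer, and set R_θ^(k) = Σ_{i=0}^{k−1}(−η²BBᵀ)^i and R_φ^(k) = Σ_{i=0}^{k−1}(−η²BᵀB)^i. Then for all vectors u ∈ ℝ^m and v ∈ ℝ^n, ‖R_θ^(k)(u − ηBv)‖² + ‖R_φ^(k)(ηBᵀu + v)‖² = ((I_m − (−η²BBᵀ)^k) u)ᵀ (I_m + η²BBᵀ)^{-1} ((I_m − (−η²BBᵀ)^k) u) + ((I_n − (−η²BᵀB)^k) v)ᵀ (I_n + η²BᵀB)^{-1} ((I_n − (−η²BᵀB)^k) v). -/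
open Matrix Filter Topology

/-- The squared Euclidean norm of a vector `v : ι → ℝ`. -/
noncomputable def eNormSq {ι : Type*} [Fintype ι] (v : ι → ℝ) : ℝ :=
  ‖(EuclideanSpace.equiv ι ℝ).symm v‖ ^ 2

theorem aux_eNormSq {ι : Type*} [Fintype ι] (v : ι → ℝ) : eNormSq v = v ⬝ᵥ v := by
  unfold eNormSq
  rw [EuclideanSpace.real_norm_sq_eq]
  simp [dotProduct, sq]

theorem aux_unit {m n : ℕ} (C : Matrix (Fin m) (Fin n) ℝ) :
    IsUnit (1 + C * Cᵀ).det := by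
  have h : (1 + C * Cᵀ).PosDef := by
    have h1 : (C * Cᵀ).PosSemidef := by
      simpa using Matrix.posSemidef_self_mul_conjTranspose C
    exact Matrix.PosDef.one.add_posSemidef h1
  exact h.det_pos.ne'.isUnit

theorem aux_pow {m n : ℕ} (C : Matrix (Fin m) (Fin n) ℝ) (i : ℕ) :
    (-(C * Cᵀ)) ^ i * C = C * (-(Cᵀ * C)) ^ i := by
  induction i with
  | zero => simp
  | succ i ih =>
    rw [pow_succ, pow_succ', Matrix.mul_assoc]
    have : -(C * Cᵀ) * C = C * -(Cᵀ * C) := by simp [Matrix.mul_assoc]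
    rw [this, ← Matrix.mul_assoc, ih, Matrix.mul_assoc, ← pow_succ, ← pow_succ']

theorem aux_sum {m n : ℕ} (C : Matrix (Fin m) (Fin n) ℝ) (k : ℕ) :
    (∑ i ∈ Finset.range k, (-(C * Cᵀ)) ^ i) * C
      = C * ∑ i ∈ Finset.range k, (-(Cᵀ * C)) ^ i := by
  rw [Matrix.sum_mul, Matrix.mul_sum]
  exact Finset.sum_congr rfl fun i _ => aux_pow C i

theorem aux_quad {m n : ℕ} (C : Matrix (Fin m) (Fin n) ℝ) (k : ℕ) (u : Fin m → ℝ) :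
    ((1 - (-(C * Cᵀ)) ^ k) *ᵥ u) ⬝ᵥ ((1 + C * Cᵀ)⁻¹ *ᵥ ((1 - (-(C * Cᵀ)) ^ k) *ᵥ u))
      = ((∑ i ∈ Finset.range k, (-(C * Cᵀ)) ^ i) *ᵥ u) ⬝ᵥ
          ((∑ i ∈ Finset.range k, (-(C * Cᵀ)) ^ i) *ᵥ u)
        + (Cᵀ *ᵥ ((∑ i ∈ Finset.range k, (-(C * Cᵀ)) ^ i) *ᵥ u)) ⬝ᵥ
          (Cᵀ *ᵥ ((∑ i ∈ Finset.range k, (-(C * Cᵀ)) ^ i) *ᵥ u)) := by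
  have h : 1 - (-(C * Cᵀ)) ^ k = (1 + C * Cᵀ) * ∑ i ∈ Finset.range k, (-(C * Cᵀ)) ^ i := by
    rw [← mul_neg_geom_sum, sub_neg_eq_add]
  rw [h, Matrix.mulVec_mulVec _ (1 + C * Cᵀ)⁻¹, Matrix.nonsing_inv_mul_cancel_left _ _ (aux_unit C),
    ← Matrix.mulVec_mulVec]
  generalize (∑ i ∈ Finset.range k, (-(C * Cᵀ)) ^ i) *ᵥ u = a
  rw [Matrix.add_mulVec, Matrix.one_mulVec, add_dotProduct, ← Matrix.mulVec_mulVec,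
    Matrix.dotProduct_mulVec, Matrix.vecMul_transpose, dotProduct_comm (C *ᵥ _)  a]

/-- the core quadratic identity for the Lv.2k GP partial sums
(equation (R.H.S.) in the paper's appendix). -/
theorem lv2k_gp_partial_sum_identity
    (m n : ℕ) (B : Matrix (Fin m) (Fin n) ℝ) (η : ℝ) (k : ℕ) (hk : 0 < k)
    (Rθ : Matrix (Fin m) (Fin m) ℝ) (Rφ : Matrix (Fin n) (Fin n) ℝ)
    (hRθ : Rθ = ∑ i ∈ Finset.range k, (-(η ^ 2 • (B * Bᵀ))) ^ i)
    (hRφ : Rφ = ∑ i ∈ Finset.range k, (-(η ^ 2 • (Bᵀ * B))) ^ i)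
    (u : Fin m → ℝ) (v : Fin n → ℝ) :
    eNormSq (Rθ *ᵥ (u - η • (B *ᵥ v))) + eNormSq (Rφ *ᵥ (η • (Bᵀ *ᵥ u) + v)) =
      (((1 : Matrix (Fin m) (Fin m) ℝ) - (-(η ^ 2 • (B * Bᵀ))) ^ k) *ᵥ u) ⬝ᵥ
        (((1 : Matrix (Fin m) (Fin m) ℝ) + η ^ 2 • (B * Bᵀ))⁻¹ *ᵥ
          ((((1 : Matrix (Fin m) (Fin m) ℝ) - (-(η ^ 2 • (B * Bᵀ))) ^ k)) *ᵥ u)) +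
      (((1 : Matrix (Fin n) (Fin n) ℝ) - (-(η ^ 2 • (Bᵀ * B))) ^ k) *ᵥ v) ⬝ᵥ
        (((1 : Matrix (Fin n) (Fin n) ℝ) + η ^ 2 • (Bᵀ * B))⁻¹ *ᵥ
          ((((1 : Matrix (Fin n) (Fin n) ℝ) - (-(η ^ 2 • (Bᵀ * B))) ^ k)) *ᵥ v)) := by
  have e1 : η ^ 2 • (B * Bᵀ) = (η • B) * (η • B)ᵀ := by
    simp [smul_smul, sq]
  have e2 : η ^ 2 • (Bᵀ * B) = (η • B)ᵀ * (η • B) := by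
    simp [smul_smul, sq]
  have e3 : η • (B *ᵥ v) = (η • B) *ᵥ v := by rw [Matrix.smul_mulVec]
  have e4 : η • (Bᵀ *ᵥ u) = (η • B)ᵀ *ᵥ u := by rw [Matrix.transpose_smul, Matrix.smul_mulVec]
  rw [e1] at hRθ
  rw [e2] at hRφ
  rw [e1, e2, e3, e4]
  generalize η • B = C at *
  have q1 := aux_quad C k u
  have q2 := aux_quad Cᵀ k v
  have s1 := aux_sum C k
  have s2 := aux_sum Cᵀ k
  rw [Matrix.transpose_transpose] at q2 s2
  rw [← hRθ] at q1 s1 s2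
  rw [← hRφ] at q2 s1 s2
  rw [q1, q2, aux_eNormSq, aux_eNormSq, Matrix.mulVec_sub, Matrix.mulVec_add,
    Matrix.mulVec_mulVec, Matrix.mulVec_mulVec, s1, s2, ← Matrix.mulVec_mulVec,
    ← Matrix.mulVec_mulVec]
  generalize Rθ *ᵥ u = a
  generalize Rφ *ᵥ v = b
  have hc : (Cᵀ *ᵥ a) ⬝ᵥ b = a ⬝ᵥ (C *ᵥ b) := by
    rw [Matrix.mulVec_transpose, Matrix.dotProduct_mulVec]
  simp only [sub_dotProduct, dotProduct_sub, add_dotProduct, dotProduct_add]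
  rw [dotProduct_comm b, dotProduct_comm (C *ᵥ b) a, hc]
  ring
end
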